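/- There exists a constant C > 0 such that for every integer a ≥ 3 the following holds: letting T_a(N) denote the number of ordered pairs (n₁, n₂) of integers with 1 ≤ n₁, n₂ ≤ N such that gcd(n₁, n₂) = 1, gcd(a, n₁) = 1, and gcd(a, n₂) = 1, one has liminf_{N → ∞} T_a(N)/N² ≥ C / (log(log a))². -/

import Mathlib

open Filter Real

lemma sum_Icc_two_inv_mul_pred (N : ℕ) :
    ∑ d ∈ Finset.Icc 2 N, (1 : ℝ) / (d * (d - 1)) ≤ 1 := by
  have key : ∀ n : ℕ, ∑ d ∈ Finset.Icc 2 (n + 1), (1 : ℝ) / (d * (d - 1)) = 1 - 1 / (n + 1) := by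
    intro n
    induction n with
    | zero => simp
    | succ n ih =>
      rw [Finset.sum_Icc_succ_top (by omega), ih]
      push_cast
      field_simp
      ring
  rcases N with _ | n
  · simp
  · rw [key]
    have : (0 : ℝ) ≤ 1 / (n + 1) := by positivity
    linarith

lemma sum_Icc_two_inv_sq_le (N : ℕ) :
    ∑ d ∈ Finset.Icc 2 N, (1 : ℝ) / (d : ℝ) ^ 2 ≤ 3 / 4 := by
  have key : ∀ n : ℕ,
      ∑ d ∈ Finset.Icc 2 (n + 2), (1 : ℝ) / (d : ℝ) ^ 2 ≤ 3 / 4 - 1 / (n + 2) := by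
    intro n
    induction n with
    | zero => norm_num
    | succ n ih =>
      rw [Finset.sum_Icc_succ_top (by omega)]
      have h : (1 : ℝ) / ((n + 2 + 1 : ℕ) : ℝ) ^ 2 ≤ 1 / (n + 2) - 1 / ((n + 1 : ℕ) + 2) := by
        push_cast
        rw [div_sub_div _ _ (by positivity) (by positivity),
          div_le_div_iff₀ (by positivity) (by positivity)]
        nlinarith [Nat.cast_nonneg (α := ℝ) n]
      linarith
  rcases N with _ | _ | n
  · norm_num
  · norm_num
  · have h := key n
    have : (0 : ℝ) ≤ 1 / (n + 2) := by positivity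
    linarith

lemma pow_div_dvd_factorial (N p : ℕ) (hp : 0 < p) : p ^ (N / p) ∣ N.factorial := by
  have h := Nat.prod_factorial_dvd_factorial_sum (Finset.range (N / p)) (fun _ => p)
  simp only [Finset.prod_const, Finset.card_range, Finset.sum_const, smul_eq_mul] at h
  exact (pow_dvd_pow_of_dvd (Nat.dvd_factorial hp le_rfl) _).trans
    (h.trans (Nat.factorial_dvd_factorial (Nat.div_mul_le_self N p)))

/-- The upper bound in the first theorem of Mertens. -/
lemma sum_primesLE_log_div_le {N : ℕ} (hN : 0 < N) :
    ∑ p ∈ N.primesLE, log p / p ≤ log N + log 4 := by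
  have hpr : ∀ p ∈ N.primesLE, p.Prime := fun p hp => by
    rw [Nat.mem_primesLE] at hp; exact hp.2
  have hdvd : ∏ p ∈ N.primesLE, p ^ (N / p) ∣ N.factorial := by
    apply Finset.prod_dvd_of_isRelPrime
    · intro p hp q hq hpq
      simp only [Function.onFun]
      rw [← Nat.coprime_iff_isRelPrime]
      exact Nat.Coprime.pow _ _ ((Nat.coprime_primes (hpr p hp) (hpr q hq)).2 hpq)
    · intro p hp
      exact pow_div_dvd_factorial N p (hpr p hp).pos
  have hle : ∏ p ∈ N.primesLE, p ^ (N / p) ≤ N ^ N :=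
    (Nat.le_of_dvd N.factorial_pos hdvd).trans N.factorial_le_pow
  have hlog : ∑ p ∈ N.primesLE, ((N / p : ℕ) : ℝ) * log p ≤ N * log N := by
    have h1 : ((∏ p ∈ N.primesLE, p ^ (N / p) : ℕ) : ℝ) ≤ (N : ℝ) ^ N := by exact_mod_cast hle
    have h2 := Real.log_le_log (by
      exact_mod_cast Finset.prod_pos fun p hp => pow_pos (hpr p hp).pos _) h1
    push_cast at h2
    rw [Real.log_prod (fun p hp => by
      have := (hpr p hp).pos
      positivity), Real.log_pow] at h2
    simpa only [Real.log_pow] using h2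
  have htheta : ∑ p ∈ N.primesLE, log p ≤ log 4 * N := by
    rw [← Chebyshev.theta_eq_sum_primesLE_log]
    exact Chebyshev.theta_le_log4_mul_x (Nat.cast_nonneg N)
  have hN' : (0 : ℝ) < N := by exact_mod_cast hN
  refine le_of_mul_le_mul_left ?_ hN'
  rw [Finset.mul_sum]
  calc ∑ p ∈ N.primesLE, (N : ℝ) * (log p / p)
      ≤ ∑ p ∈ N.primesLE, (((N / p : ℕ) : ℝ) * log p + log p) := by
        refine Finset.sum_le_sum fun p hp => ?_
        have h := (Nat.lt_floor_add_one ((N : ℝ) / p)).le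
        rw [Nat.floor_div_eq_div] at h
        have := mul_le_mul_of_nonneg_right h (Real.log_natCast_nonneg p)
        calc (N : ℝ) * (log p / p) = N / p * log p := by ring
          _ ≤ _ := this.trans_eq (by ring)
    _ ≤ N * (log N + log 4) := by
        rw [Finset.sum_add_distrib]
        linarith

/-- The monoid homomorphism `n ↦ n ^ (-s)`. -/
noncomputable def natRpowNegHom (s : ℝ) : ℕ →* ℝ where
  toFun n := (n : ℝ) ^ (-s)
  map_one' := by simp
  map_mul' m n := by
    push_cast
    exact Real.mul_rpow (Nat.cast_nonneg m) (Nat.cast_nonneg n)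

lemma tsum_natCast_rpow_neg_le {s : ℝ} (hs : 1 < s) :
    ∑' n : ℕ, (n : ℝ) ^ (-s) ≤ 1 + 1 / (s - 1) := by
  have hsum : Summable fun n : ℕ => (n : ℝ) ^ (-s) := Real.summable_nat_rpow.2 (by linarith)
  rw [hsum.tsum_eq_zero_add]
  have h := ZetaAsymptotics.zeta_limit_aux1 hs
  have hnn : 0 ≤ ZetaAsymptotics.termTSum s := tsum_nonneg fun n => ZetaAsymptotics.term_nonneg _ _
  have heq : ∑' n : ℕ, (((n + 1 : ℕ) : ℝ)) ^ (-s) = ∑' n : ℕ, 1 / (n + 1 : ℝ) ^ s := by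
    congr 1; ext n
    push_cast
    rw [Real.rpow_neg (by positivity), one_div]
  rw [heq, Nat.cast_zero, Real.zero_rpow (by linarith)]
  nlinarith

lemma sum_primesLE_rpow_neg_le {s : ℝ} (hs : 1 < s) (N : ℕ) :
    ∑ p ∈ N.primesLE, (p : ℝ) ^ (-s) ≤ log (1 + 1 / (s - 1)) := by
  have hsum : Summable (natRpowNegHom s) := Real.summable_nat_rpow.2 (by linarith)
  have h := EulerProduct.prod_primesBelow_geometric_eq_tsum_smoothNumbers hsum (N + 1)
  have h2 : ∑' m : (N + 1).smoothNumbers, natRpowNegHom s m ≤ ∑' n, natRpowNegHom s n :=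
    hsum.tsum_subtype_le _ _ (fun n => Real.rpow_nonneg (Nat.cast_nonneg n) _)
  have h3 := tsum_natCast_rpow_neg_le hs
  rw [Real.le_log_iff_exp_le (by have : 0 < s - 1 := by linarith
                                 positivity), Real.exp_sum]
  refine le_trans ?_ ((h.trans_le h2).trans h3)
  refine Finset.prod_le_prod (fun _ _ => (Real.exp_pos _).le) fun p hp => ?_
  have hp1 : p.Prime := Nat.prime_of_mem_primesBelow hp
  have hlt : (p : ℝ) ^ (-s) < 1 :=
    Real.rpow_lt_one_of_one_lt_of_neg (by exact_mod_cast hp1.one_lt) (by linarith)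
  rw [le_inv_comm₀ (Real.exp_pos _) (by change 0 < 1 - (p : ℝ) ^ (-s); linarith), ← Real.exp_neg]
  exact Real.one_sub_le_exp_neg _

/-- An upper bound of the strength of the second theorem of Mertens, on choosing `ε = 1 / log N`. -/
lemma sum_primesLE_inv_le {N : ℕ} (hN : 0 < N) {ε : ℝ} (hε : 0 < ε) :
    ∑ p ∈ N.primesLE, (1 : ℝ) / p ≤ log (1 + 1 / ε) + ε * (log N + log 4) := by
  have h1 := sum_primesLE_rpow_neg_le (s := 1 + ε) (by linarith) N
  have h2 := mul_le_mul_of_nonneg_left (sum_primesLE_log_div_le hN) hε.le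
  rw [add_sub_cancel_left] at h1
  refine le_trans ?_ (add_le_add h1 h2)
  rw [Finset.mul_sum, ← Finset.sum_add_distrib]
  refine Finset.sum_le_sum fun p hp => ?_
  have hp0 : (0 : ℝ) < p := by
    rw [Nat.mem_primesLE] at hp; exact_mod_cast hp.2.pos
  have h3 : (p : ℝ) ^ (-(1 + ε)) = 1 / p * exp (-(ε * log p)) := by
    rw [neg_add, Real.rpow_add hp0, Real.rpow_neg_one, one_div, Real.rpow_def_of_pos hp0 (-ε)]
    congr 2; ring
  rw [h3]
  have h4 := mul_le_mul_of_nonneg_left (Real.one_sub_le_exp_neg (ε * log p))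
    (one_div_pos.2 hp0).le
  calc (1 : ℝ) / p = 1 / p * (1 - ε * log p) + ε * (log p / p) := by ring
    _ ≤ _ := by linarith

lemma card_primeFactors_mul_log_two_le {a : ℕ} (ha : a ≠ 0) :
    (a.primeFactors.card : ℝ) * log 2 ≤ log a := by
  have h : 2 ^ a.primeFactors.card ≤ a :=
    (Finset.pow_card_le_prod _ _ _ fun p hp => (Nat.prime_of_mem_primeFactors hp).two_le).trans
      (Nat.le_of_dvd (Nat.pos_of_ne_zero ha) (Nat.prod_primeFactors_dvd a))
  rw [← Real.log_pow]
  exact Real.log_le_log (by positivity) (by exact_mod_cast h)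

lemma sum_primeFactors_inv_le {a : ℕ} (ha : 1 ≤ log (log a)) :
    ∑ p ∈ a.primeFactors, (1 : ℝ) / p ≤ log (1 + log (log a)) + log 4 + 3 := by
  set L := log (log a) with hL
  have hx1 : exp 1 ≤ log a := by
    have h0 : 0 < log (a : ℝ) := by
      refine (Real.log_natCast_nonneg a).lt_of_ne fun h => ?_
      rw [hL, ← h, Real.log_zero] at ha
      linarith
    exact (Real.le_log_iff_exp_le h0).1 ha
  have he := Real.exp_one_gt_d9
  have hx0 : 0 < log a := by linarith
  have ha0 : a ≠ 0 := by rintro rfl; simp at hx0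
  set N := ⌊log a⌋₊ with hNdef
  have hN : 0 < N := Nat.floor_pos.2 (by linarith)
  have hN' : (0 : ℝ) < N := by exact_mod_cast hN
  have hNL : log N ≤ L := Real.log_le_log hN' (Nat.floor_le hx0.le)
  have hL0 : 0 < L := by linarith
  have hsmall := sum_primesLE_inv_le hN (ε := 1 / L) (by positivity)
  rw [one_div_one_div] at hsmall
  have hb : 1 / L * (log N + log 4) ≤ 1 + log 4 := by
    rw [one_div_mul_eq_div, div_le_iff₀ hL0]
    have : 0 ≤ log 4 := Real.log_nonneg (by norm_num)
    nlinarith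
  have hlarge : ∑ p ∈ a.primeFactors with ¬ p ≤ N, (1 : ℝ) / p ≤ 2 := by
    have hc := card_primeFactors_mul_log_two_le ha0
    have h2 := Real.log_two_gt_d9
    calc ∑ p ∈ a.primeFactors with ¬ p ≤ N, (1 : ℝ) / p
        ≤ ∑ p ∈ a.primeFactors with ¬ p ≤ N, 1 / log a := by
          refine Finset.sum_le_sum fun p hp => ?_
          have hp' : N < p := by simpa using (Finset.mem_filter.1 hp).2
          exact one_div_le_one_div_of_le hx0 ((Nat.lt_of_floor_lt hp').le)
      _ ≤ ∑ p ∈ a.primeFactors, 1 / log a :=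
          Finset.sum_le_sum_of_subset_of_nonneg (Finset.filter_subset _ _)
            fun _ _ _ => by positivity
      _ = a.primeFactors.card / log a := by simp [div_eq_mul_inv]
      _ ≤ 2 := by
          rw [div_le_iff₀ hx0]
          nlinarith [Nat.cast_nonneg (α := ℝ) a.primeFactors.card]
  have hsub : ∑ p ∈ a.primeFactors with p ≤ N, (1 : ℝ) / p ≤ ∑ p ∈ N.primesLE, (1 : ℝ) / p := by
    refine Finset.sum_le_sum_of_subset_of_nonneg (fun p hp => ?_) fun _ _ _ => by positivity
    rw [Finset.mem_filter] at hp
    exact Nat.mem_primesLE.2 ⟨hp.2, Nat.prime_of_mem_primeFactors hp.1⟩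
  rw [← Finset.sum_filter_add_sum_filter_not _ (fun p => p ≤ N)]
  linarith

lemma exp_neg_sum_primeFactors_le_totient_div (a : ℕ) (ha : a ≠ 0) :
    exp (-(∑ p ∈ a.primeFactors, (1 : ℝ) / p + 1)) ≤ (a.totient : ℝ) / a := by
  have h := Nat.totient_eq_mul_prod_factors a
  have h' : (a.totient : ℝ) = a * ∏ p ∈ a.primeFactors, (1 - (p : ℝ)⁻¹) := by
    simpa using congrArg (Rat.cast : ℚ → ℝ) h
  have ha' : (a : ℝ) ≠ 0 := by exact_mod_cast ha
  rw [h', mul_div_cancel_left₀ _ ha']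
  have hsum : ∑ p ∈ a.primeFactors, (1 : ℝ) / (p * (p - 1)) ≤ 1 := by
    refine le_trans ?_ (sum_Icc_two_inv_mul_pred a)
    refine Finset.sum_le_sum_of_subset_of_nonneg (fun p hp => ?_) fun d hd _ => ?_
    · exact Finset.mem_Icc.2 ⟨(Nat.prime_of_mem_primeFactors hp).two_le,
        Nat.le_of_mem_primeFactors hp⟩
    · have : (2 : ℝ) ≤ d := by exact_mod_cast (Finset.mem_Icc.1 hd).1
      have : (0 : ℝ) < d - 1 := by linarith
      positivity
  calc exp (-(∑ p ∈ a.primeFactors, (1 : ℝ) / p + 1))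
      ≤ exp (∑ p ∈ a.primeFactors, -((1 : ℝ) / p + 1 / (p * (p - 1)))) := by
        rw [Finset.sum_neg_distrib, Finset.sum_add_distrib]
        gcongr
    _ ≤ _ := by
        rw [Real.exp_sum]
        refine Finset.prod_le_prod (fun _ _ => (Real.exp_pos _).le) fun p hp => ?_
        have h2 : (2 : ℝ) ≤ p := by exact_mod_cast (Nat.prime_of_mem_primeFactors hp).two_le
        have h1 : (0 : ℝ) < p - 1 := by linarith
        rw [Real.exp_neg, inv_le_comm₀ (Real.exp_pos _) (by
          have : (p : ℝ)⁻¹ ≤ 2⁻¹ := inv_anti₀ (by norm_num) h2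
          linarith)]
        refine le_trans (le_of_eq ?_) (Real.add_one_le_exp _)
        field_simp
        ring

lemma exists_div_log_log_le_totient_div :
    ∃ c : ℝ, 0 < c ∧ ∀ a : ℕ, 3 ≤ a →
      0 < log (log (a : ℝ)) ∧ c / log (log (a : ℝ)) ≤ (a.totient : ℝ) / a := by
  have he3 : exp 1 < 3 := Real.exp_one_lt_three
  have hlog3 : 1 < log 3 := (Real.lt_log_iff_exp_lt (by norm_num)).2 he3
  have hl3 : 0 < log (log 3) := Real.log_pos hlog3
  refine ⟨min (log (log 3) / 27) (exp (-(log 8 + 4))), by positivity, fun a ha => ?_⟩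
  have ha3 : (3 : ℝ) ≤ a := by exact_mod_cast ha
  have hmono : log (log 3) ≤ log (log a) :=
    Real.log_le_log (by linarith) (Real.log_le_log (by norm_num) ha3)
  have hL : 0 < log (log (a : ℝ)) := hl3.trans_le hmono
  have hloga : 1 < log (a : ℝ) := hlog3.trans_le (Real.log_le_log (by norm_num) ha3)
  refine ⟨hL, ?_⟩
  rw [div_le_iff₀ hL]
  have ha0 : (0 : ℝ) < a := by linarith
  rcases lt_or_ge (log (log (a : ℝ))) 1 with hlt | hge
  · refine (min_le_left _ _).trans ?_
    have h1 : log (a : ℝ) < 3 := ((Real.log_lt_iff_lt_exp (by linarith)).1 hlt).trans he3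
    have h2 : (a : ℝ) < 27 := by
      refine ((Real.log_lt_iff_lt_exp ha0).1 h1).trans_le ?_
      calc exp 3 = exp 1 ^ 3 := by rw [← Real.exp_nat_mul]; norm_num
        _ ≤ 3 ^ 3 := by gcongr
        _ = 27 := by norm_num
    have h3 : (1 : ℝ) ≤ a.totient := by
      exact_mod_cast Nat.totient_pos.2 (by omega)
    have h4 : (1 : ℝ) / 27 ≤ a.totient / a := by gcongr
    calc log (log 3) / 27 = 1 / 27 * log (log 3) := by ring
      _ ≤ _ := by gcongr
  · refine (min_le_right _ _).trans ?_
    have h1 := sum_primeFactors_inv_le hge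
    rw [← div_le_iff₀ hL]
    refine le_trans ?_ (exp_neg_sum_primeFactors_le_totient_div a (by omega))
    have h2 : log (1 + log (log (a : ℝ))) ≤ log 2 + log (log (log a)) := by
      rw [← Real.log_mul (by norm_num) hL.ne']
      exact Real.log_le_log (by linarith) (by linarith)
    have h3 : log 8 = log 2 + log 4 := by
      rw [← Real.log_mul (by norm_num) (by norm_num)]; norm_num
    rw [div_eq_mul_inv, ← Real.exp_log (inv_pos.2 hL), ← Real.exp_add, Real.log_inv]
    gcongr
    linarith

/-- The number of integers in `{1, …, N}` coprime to `a`. -/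
def coprimeCount (a N : ℕ) : ℕ := ((Finset.Icc 1 N).filter (fun n => Nat.gcd a n = 1)).card

lemma coprimeCount_mul (a k : ℕ) : coprimeCount a (a * k) = a.totient * k := by
  induction k with
  | zero => simp [coprimeCount]
  | succ k ih =>
    have h : Finset.Icc 1 (a * (k + 1)) =
        Finset.Icc 1 (a * k) ∪ Finset.Ico (a * k + 1) (a * k + 1 + a) := by
      ext x
      simp only [Finset.mem_Icc, Finset.mem_union, Finset.mem_Ico, mul_add, mul_one]
      omega
    have hd : Disjoint (Finset.Icc 1 (a * k)) (Finset.Ico (a * k + 1) (a * k + 1 + a)) := by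
      rw [Finset.disjoint_left]
      intro x hx hx'
      simp only [Finset.mem_Icc, Finset.mem_Ico] at hx hx'
      omega
    have h2 := Nat.filter_coprime_Ico_eq_totient a (a * k + 1)
    simp only [Nat.Coprime] at h2
    unfold coprimeCount at ih ⊢
    rw [h, Finset.filter_union, Finset.card_union_of_disjoint
      (Finset.disjoint_filter_filter hd), ih, h2, mul_add, mul_one]

lemma coprimeCount_mono (a : ℕ) : Monotone (coprimeCount a) := fun M N h => by
  unfold coprimeCount
  gcongr

lemma coprimeCount_le {a : ℕ} (ha : 0 < a) (N : ℕ) :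
    (coprimeCount a N : ℝ) ≤ a.totient / a * N + a := by
  have h1 : coprimeCount a N ≤ a.totient * (N / a + 1) := by
    rw [← coprimeCount_mul]
    exact coprimeCount_mono a (Nat.lt_mul_div_succ N ha).le
  have h2 : (coprimeCount a N : ℝ) ≤ a.totient * ((N / a : ℕ) + 1) := by exact_mod_cast h1
  have h3 : (a.totient : ℝ) ≤ a := by exact_mod_cast Nat.totient_le a
  have h4 : ((N / a : ℕ) : ℝ) ≤ N / a := Nat.cast_div_le
  calc (coprimeCount a N : ℝ) ≤ a.totient * ((N / a : ℕ) + 1) := h2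
    _ ≤ a.totient * (N / a + 1) := by gcongr
    _ = a.totient / a * N + a.totient := by ring
    _ ≤ _ := by linarith

lemma le_coprimeCount {a : ℕ} (N : ℕ) :
    (a.totient / a * N - a : ℝ) ≤ coprimeCount a N := by
  have h1 : a.totient * (N / a) ≤ coprimeCount a N := by
    rw [← coprimeCount_mul]
    exact coprimeCount_mono a (Nat.mul_div_le N a)
  have h2 : (a.totient : ℝ) * (N / a : ℕ) ≤ coprimeCount a N := by exact_mod_cast h1
  have h3 : (a.totient : ℝ) ≤ a := by exact_mod_cast Nat.totient_le a
  have h4 : (N : ℝ) / a ≤ (N / a : ℕ) + 1 := by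
    rw [← Nat.floor_div_eq_div (K := ℝ)]
    exact (Nat.lt_floor_add_one _).le
  have h5 := mul_le_mul_of_nonneg_left h4 (Nat.cast_nonneg (α := ℝ) a.totient)
  calc (a.totient / a * N - a : ℝ) = a.totient * (N / a) - a := by ring
    _ ≤ coprimeCount a N := by linarith

/-- The pairs in `{1, …, N}²` that are pairwise coprime together with `a`. -/
def coprimePairs (a N : ℕ) : Finset (ℕ × ℕ) :=
  ((Finset.Icc 1 N) ×ˢ (Finset.Icc 1 N)).filter
    (fun p : ℕ × ℕ => Nat.gcd p.1 p.2 = 1 ∧ Nat.gcd a p.1 = 1 ∧ Nat.gcd a p.2 = 1)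

/-- Classifying pairs of integers coprime to `a` by their greatest common divisor. -/
lemma coprimeCount_sq_le (a N : ℕ) :
    coprimeCount a N ^ 2 ≤
      (coprimePairs a N).card + ∑ d ∈ Finset.Icc 2 N, coprimeCount a (N / d) ^ 2 := by
  let S : ℕ → Finset ℕ := fun M => (Finset.Icc 1 M).filter (fun n => Nat.gcd a n = 1)
  have hS : ∀ M, ((S M) ×ˢ (S M)).card = coprimeCount a M ^ 2 := fun M => by
    rw [Finset.card_product, sq]; rfl
  have hsub : (S N) ×ˢ (S N) ⊆ coprimePairs a N ∪ (Finset.Icc 2 N).biUnion fun d =>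
      ((S (N / d)) ×ˢ (S (N / d))).image fun q : ℕ × ℕ => (d * q.1, d * q.2) := by
    rintro ⟨m, n⟩ hmn
    simp only [S, Finset.mem_product, Finset.mem_filter, Finset.mem_Icc] at hmn
    obtain ⟨⟨⟨hm1, hmN⟩, hma⟩, ⟨hn1, hnN⟩, hna⟩ := hmn
    rw [Finset.mem_union]
    by_cases hg : Nat.gcd m n = 1
    · left
      simp only [coprimePairs, Finset.mem_product, Finset.mem_filter, Finset.mem_Icc]
      exact ⟨⟨⟨hm1, hmN⟩, hn1, hnN⟩, hg, hma, hna⟩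
    · right
      have hgpos : 0 < Nat.gcd m n := Nat.gcd_pos_of_pos_left n hm1
      obtain ⟨m', hm'⟩ := Nat.gcd_dvd_left m n
      obtain ⟨n', hn'⟩ := Nat.gcd_dvd_right m n
      have hle : Nat.gcd m n ≤ N := (Nat.gcd_le_left n hm1).trans hmN
      generalize Nat.gcd m n = d at *
      subst hm' hn'
      simp only [S, Finset.mem_biUnion, Finset.mem_image, Finset.mem_product, Finset.mem_filter,
        Finset.mem_Icc, Prod.mk.injEq, Prod.exists]
      refine ⟨d, ⟨by omega, hle⟩, m', n', ⟨⟨⟨Nat.pos_of_mul_pos_left hm1, ?_⟩, ?_⟩,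
        ⟨Nat.pos_of_mul_pos_left hn1, ?_⟩, ?_⟩, rfl, rfl⟩
      · rw [Nat.le_div_iff_mul_le hgpos, mul_comm]; exact hmN
      · exact Nat.Coprime.coprime_mul_left_right hma
      · rw [Nat.le_div_iff_mul_le hgpos, mul_comm]; exact hnN
      · exact Nat.Coprime.coprime_mul_left_right hna
  rw [← hS]
  refine (Finset.card_le_card hsub).trans ((Finset.card_union_le _ _).trans ?_)
  gcongr
  refine Finset.card_biUnion_le.trans (Finset.sum_le_sum fun d _ => ?_)
  rw [← hS]
  exact Finset.card_image_le

lemma le_card_coprimePairs {a : ℕ} (ha : 0 < a) (N : ℕ) :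
    ((a.totient : ℝ) / a) ^ 2 / 4 * N ^ 2 - (a ^ 2 + 4 * a) * N - 2 * a * (N * log N) ≤
      (coprimePairs a N).card := by
  have ha' : (0 : ℝ) < a := by exact_mod_cast ha
  set δ : ℝ := (a.totient : ℝ) / a with hδ
  have hδ0 : 0 ≤ δ := by positivity
  have hδ1 : δ ≤ 1 := by
    rw [hδ, div_le_one ha']
    exact_mod_cast Nat.totient_le a
  have hN0 : (0 : ℝ) ≤ N := Nat.cast_nonneg N
  have hmain : (coprimeCount a N : ℝ) ^ 2 ≤
      (coprimePairs a N).card + ∑ d ∈ Finset.Icc 2 N, (coprimeCount a (N / d) : ℝ) ^ 2 := by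
    exact_mod_cast coprimeCount_sq_le a N
  have hlow : (δ * N) ^ 2 - 2 * a * N ≤ (coprimeCount a N : ℝ) ^ 2 := by
    have h := le_coprimeCount (a := a) N
    rw [← hδ] at h
    have h1 := mul_le_mul_of_nonneg_left h (mul_nonneg hδ0 hN0)
    have h2 : δ * (a * N) ≤ 1 * (a * N) := by gcongr
    nlinarith [sq_nonneg ((coprimeCount a N : ℝ) - δ * N)]
  have hharm : ∑ d ∈ Finset.Icc 2 N, (1 : ℝ) / d ≤ 1 + log N := by
    have h := harmonic_le_one_add_log N
    rw [harmonic_eq_sum_Icc] at h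
    push_cast at h
    refine le_trans ?_ h
    simp only [one_div]
    exact Finset.sum_le_sum_of_subset_of_nonneg (Finset.Icc_subset_Icc_left (by norm_num))
      fun _ _ _ => by positivity
  have hup : ∑ d ∈ Finset.Icc 2 N, (coprimeCount a (N / d) : ℝ) ^ 2 ≤
      δ ^ 2 * N ^ 2 * (3 / 4) + 2 * a * N * (1 + log N) + a ^ 2 * N := by
    calc ∑ d ∈ Finset.Icc 2 N, (coprimeCount a (N / d) : ℝ) ^ 2
        ≤ ∑ d ∈ Finset.Icc 2 N,
            (δ ^ 2 * N ^ 2 * (1 / (d : ℝ) ^ 2) + 2 * a * N * (1 / d) + a ^ 2) := by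
          refine Finset.sum_le_sum fun d _ => ?_
          have h1 := coprimeCount_le ha (N / d)
          have h2 : ((N / d : ℕ) : ℝ) ≤ N / d := Nat.cast_div_le
          calc (coprimeCount a (N / d) : ℝ) ^ 2 ≤ (δ * (N / d) + a) ^ 2 := by
                gcongr
                exact h1.trans (by gcongr)
            _ = δ ^ 2 * N ^ 2 * (1 / (d : ℝ) ^ 2) + δ * (2 * a * N * (1 / d)) + a ^ 2 := by ring
            _ ≤ δ ^ 2 * N ^ 2 * (1 / (d : ℝ) ^ 2) + 1 * (2 * a * N * (1 / d)) + a ^ 2 := by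
                gcongr
            _ = _ := by ring
      _ = δ ^ 2 * N ^ 2 * ∑ d ∈ Finset.Icc 2 N, 1 / (d : ℝ) ^ 2 +
            2 * a * N * ∑ d ∈ Finset.Icc 2 N, 1 / (d : ℝ) + a ^ 2 * (Finset.Icc 2 N).card := by
          rw [Finset.sum_add_distrib, Finset.sum_add_distrib, ← Finset.mul_sum, ← Finset.mul_sum,
            Finset.sum_const, nsmul_eq_mul, mul_comm (a ^ 2 : ℝ)]
      _ ≤ _ := by
          have h3 : ((Finset.Icc 2 N).card : ℝ) ≤ N := by
            rw [Nat.card_Icc]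
            exact_mod_cast (by omega : N + 1 - 2 ≤ N)
          gcongr
          exact sum_Icc_two_inv_sq_le N
  linarith

/-- The probability that `a, n₁, n₂` are pairwise coprime is `Ω((1/log log a)²)`:
there is a constant `C > 0` such that for every integer `a ≥ 3`, the density of pairs
`(n₁, n₂)` in `{1, …, N}²` with `a, n₁, n₂` pairwise coprime has `liminf` at least
`C / (log log a)²`. -/
theorem continuous_shor_condition_A_probability :
    ∃ C : ℝ, 0 < C ∧ ∀ a : ℕ, 3 ≤ a →
      C / (Real.log (Real.log (a : ℝ))) ^ 2 ≤
        Filter.liminf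
          (fun N : ℕ =>
            ((((Finset.Icc 1 N) ×ˢ (Finset.Icc 1 N)).filter
                (fun p : ℕ × ℕ =>
                  Nat.gcd p.1 p.2 = 1 ∧ Nat.gcd a p.1 = 1 ∧ Nat.gcd a p.2 = 1)).card : ℝ) /
            (N : ℝ) ^ 2)
          atTop := by
  obtain ⟨c, hc, hφ⟩ := exists_div_log_log_le_totient_div
  refine ⟨c ^ 2 / 8, by positivity, fun a ha => ?_⟩
  obtain ⟨hL, hca⟩ := hφ a ha
  have ha0 : 0 < a := by omega
  set L := Real.log (Real.log (a : ℝ)) with hLdef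
  set δ : ℝ := (a.totient : ℝ) / a with hδ
  have hlt : c ^ 2 / 8 / L ^ 2 < δ ^ 2 / 4 := by
    have h1 : (c / L) ^ 2 ≤ δ ^ 2 := by gcongr
    have h2 : 0 < (c / L) ^ 2 := by positivity
    calc c ^ 2 / 8 / L ^ 2 = (c / L) ^ 2 / 8 := by ring
      _ < δ ^ 2 / 4 := by linarith
  have hlim : Tendsto (fun N : ℕ =>
      δ ^ 2 / 4 - (a ^ 2 + 4 * a) * (1 / (N : ℝ)) - 2 * a * (Real.log N / N)) atTop
      (nhds (δ ^ 2 / 4 - (a ^ 2 + 4 * a) * 0 - 2 * a * 0)) := by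
    have hlog : Tendsto (fun N : ℕ => Real.log N / N) atTop (nhds 0) :=
      Real.isLittleO_log_id_atTop.tendsto_div_nhds_zero.comp tendsto_natCast_atTop_atTop
    exact (tendsto_const_nhds.sub (tendsto_one_div_atTop_nhds_zero_nat.const_mul _)).sub
      (hlog.const_mul _)
  rw [mul_zero, mul_zero, sub_zero, sub_zero] at hlim
  refine le_liminf_of_le ?_ ?_
  · refine (isBoundedUnder_of ⟨1, fun N => ?_⟩ :
      IsBoundedUnder (· ≤ ·) atTop _).isCoboundedUnder_ge
    refine div_le_one_of_le₀ ?_ (by positivity)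
    have h := Finset.card_filter_le ((Finset.Icc 1 N) ×ˢ (Finset.Icc 1 N))
      (fun p : ℕ × ℕ => Nat.gcd p.1 p.2 = 1 ∧ Nat.gcd a p.1 = 1 ∧ Nat.gcd a p.2 = 1)
    rw [Finset.card_product, Nat.card_Icc, Nat.add_sub_cancel, ← sq] at h
    exact_mod_cast h
  · filter_upwards [hlim.eventually_const_lt hlt, eventually_gt_atTop 0] with N hN hN0
    have hN' : (0 : ℝ) < N := by exact_mod_cast hN0
    refine hN.le.trans ?_
    rw [le_div_iff₀ (by positivity)]
    refine le_trans (le_of_eq ?_) (le_card_coprimePairs ha0 N)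
    rw [← hδ]
    field_simp
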